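/- With the notation of the context, let ℓ₂ = 1/2 and let ℓ₁ be a half-odd-integer (ℓ₁ ∈ {1/2, 3/2, 5/2, …}). Then the vector v := χ_{1/2} + χ_{−1/2} satisfies D₀²v = −v, D₁v = −(ℓ₁² + 2ℓ₁ + 3/4)·v, D₂v = −(ℓ₁² − 1/4)·v, and D₃v = −i(ℓ₁ + 1/2)·(χ_{1/2} − χ_{−1/2}). -/

import Mathlib

open TensorProduct

noncomputable section

namespace Spin

/-- The spin-`L/2` module data: `ψ m` represents the basis vector `ψ_{m/2}`
(indices are doubled so that they are integers; `ψ m = 0` for `|m| > L`), and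
`T₀, Tp, Tm` act by `T₀ψ_n = n ψ_n`, `Tpψ_n = -√((ℓ-n)(ℓ+n+1)) ψ_{n+1}`,
`Tmψ_n = -√((ℓ+n)(ℓ-n+1)) ψ_{n-1}`, where `ℓ = L/2` and `n = m/2`. -/
def IsSpinModule {U : Type} [AddCommGroup U] [Module ℂ U]
    (L : ℕ) (ψ : ℤ → U) (T₀ Tp Tm : U →ₗ[ℂ] U) : Prop :=
  (∀ m : ℤ, (L : ℤ) < |m| → ψ m = 0) ∧
  (∀ m : ℤ, T₀ (ψ m) = ((m : ℂ) / 2) • ψ m) ∧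
  (∀ m : ℤ, Tp (ψ m) =
    ((-Real.sqrt ((((L : ℝ) - (m : ℝ)) / 2) * (((L : ℝ) + (m : ℝ)) / 2 + 1)) : ℝ) : ℂ) •
      ψ (m + 2)) ∧
  (∀ m : ℤ, Tm (ψ m) =
    ((-Real.sqrt ((((L : ℝ) + (m : ℝ)) / 2) * (((L : ℝ) - (m : ℝ)) / 2 + 1)) : ℝ) : ℂ) •
      ψ (m - 2))

variable {U V : Type} [AddCommGroup U] [Module ℂ U] [AddCommGroup V] [Module ℂ V]

/-- Action of an operator on the first tensor factor. -/
def opT (T : U →ₗ[ℂ] U) : (U ⊗[ℂ] V) →ₗ[ℂ] (U ⊗[ℂ] V) := LinearMap.rTensor V T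

/-- Action of an operator on the second tensor factor. -/
def opW (W : V →ₗ[ℂ] V) : (U ⊗[ℂ] V) →ₗ[ℂ] (U ⊗[ℂ] V) := LinearMap.lTensor U W

/-- `D₀ = i(T₀ - W₀)`. -/
def Dzero (T₀ : U →ₗ[ℂ] U) (W₀ : V →ₗ[ℂ] V) : (U ⊗[ℂ] V) →ₗ[ℂ] (U ⊗[ℂ] V) :=
  Complex.I • (opT T₀ - opW W₀)

/-- `TpTm + TmTp + WpWm + WmWp`. -/
def Dquad (Tp Tm : U →ₗ[ℂ] U) (Wp Wm : V →ₗ[ℂ] V) : (U ⊗[ℂ] V) →ₗ[ℂ] (U ⊗[ℂ] V) :=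
  opT Tp ∘ₗ opT Tm + opT Tm ∘ₗ opT Tp + opW Wp ∘ₗ opW Wm + opW Wm ∘ₗ opW Wp

/-- `TpWm + TmWp`. -/
def Across (Tp Tm : U →ₗ[ℂ] U) (Wp Wm : V →ₗ[ℂ] V) : (U ⊗[ℂ] V) →ₗ[ℂ] (U ⊗[ℂ] V) :=
  opT Tp ∘ₗ opW Wm + opT Tm ∘ₗ opW Wp

/-- `D₁ = -(1/2)(TpTm + TmTp + WpWm + WmWp) - TpWm - TmWp`. -/
def Done (Tp Tm : U →ₗ[ℂ] U) (Wp Wm : V →ₗ[ℂ] V) : (U ⊗[ℂ] V) →ₗ[ℂ] (U ⊗[ℂ] V) :=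
  (-(1 / 2 : ℂ)) • Dquad Tp Tm Wp Wm - Across Tp Tm Wp Wm

/-- `D₂ = -(1/2)(TpTm + TmTp + WpWm + WmWp) + TpWm + TmWp`. -/
def Dtwo (Tp Tm : U →ₗ[ℂ] U) (Wp Wm : V →ₗ[ℂ] V) : (U ⊗[ℂ] V) →ₗ[ℂ] (U ⊗[ℂ] V) :=
  (-(1 / 2 : ℂ)) • Dquad Tp Tm Wp Wm + Across Tp Tm Wp Wm

/-- `D₃ = i(TmWp - TpWm)`. -/
def Dthree (Tp Tm : U →ₗ[ℂ] U) (Wp Wm : V →ₗ[ℂ] V) : (U ⊗[ℂ] V) →ₗ[ℂ] (U ⊗[ℂ] V) :=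
  Complex.I • (opT Tm ∘ₗ opW Wp - opT Tp ∘ₗ opW Wm)

end Spin

namespace Spin

section SpinModule

variable {U : Type} [AddCommGroup U] [Module ℂ U] {L : ℕ} {ψ : ℤ → U} {T₀ Tp Tm : U →ₗ[ℂ] U}

/-- `T₊ ψ_{-1/2} = -(ℓ + 1/2) ψ_{1/2}`. -/
theorem IsSpinModule.raise_neg_one (h : IsSpinModule L ψ T₀ Tp Tm) :
    Tp (ψ (-1)) = (-(((L : ℂ) + 1) / 2)) • ψ 1 := by
  have hs : (((L : ℝ) - ((-1 : ℤ) : ℝ)) / 2) * (((L : ℝ) + ((-1 : ℤ) : ℝ)) / 2 + 1)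
      = (((L : ℝ) + 1) / 2) ^ 2 := by push_cast; ring
  rw [h.2.2.1 (-1), hs, Real.sqrt_sq (by positivity)]
  norm_num

/-- `T₋ ψ_{1/2} = -(ℓ + 1/2) ψ_{-1/2}`. -/
theorem IsSpinModule.lower_one (h : IsSpinModule L ψ T₀ Tp Tm) :
    Tm (ψ 1) = (-(((L : ℂ) + 1) / 2)) • ψ (-1) := by
  have hs : (((L : ℝ) + ((1 : ℤ) : ℝ)) / 2) * (((L : ℝ) - ((1 : ℤ) : ℝ)) / 2 + 1)
      = (((L : ℝ) + 1) / 2) ^ 2 := by push_cast; ring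
  rw [h.2.2.2 1, hs, Real.sqrt_sq (by positivity)]
  norm_num

/-- `T₋ T₊ ψ_{1/2} = (ℓ - 1/2)(ℓ + 3/2) ψ_{1/2}`. -/
theorem IsSpinModule.lower_raise_one (h : IsSpinModule L ψ T₀ Tp Tm) (hL : 1 ≤ L) :
    Tm (Tp (ψ 1)) = (((L : ℂ) - 1) / 2 * (((L : ℂ) + 3) / 2)) • ψ 1 := by
  have hL' : (1 : ℝ) ≤ L := by exact_mod_cast hL
  have h₁ : (((L : ℝ) - ((1 : ℤ) : ℝ)) / 2) * (((L : ℝ) + ((1 : ℤ) : ℝ)) / 2 + 1)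
      = ((L : ℝ) - 1) / 2 * (((L : ℝ) + 3) / 2) := by push_cast; ring
  have h₂ : (((L : ℝ) + ((1 + 2 : ℤ) : ℝ)) / 2) * (((L : ℝ) - ((1 + 2 : ℤ) : ℝ)) / 2 + 1)
      = ((L : ℝ) - 1) / 2 * (((L : ℝ) + 3) / 2) := by push_cast; ring
  have h₀ : 0 ≤ ((L : ℝ) - 1) / 2 * (((L : ℝ) + 3) / 2) :=
    mul_nonneg (by linarith) (by linarith)
  rw [h.2.2.1 1, map_smul, h.2.2.2 (1 + 2), h₁, h₂, smul_smul, ← Complex.ofReal_mul,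
    neg_mul_neg, Real.mul_self_sqrt h₀, add_sub_cancel_right]
  push_cast
  rfl

/-- `T₊ T₋ ψ_{-1/2} = (ℓ - 1/2)(ℓ + 3/2) ψ_{-1/2}`. -/
theorem IsSpinModule.raise_lower_neg_one (h : IsSpinModule L ψ T₀ Tp Tm) (hL : 1 ≤ L) :
    Tp (Tm (ψ (-1))) = (((L : ℂ) - 1) / 2 * (((L : ℂ) + 3) / 2)) • ψ (-1) := by
  have hL' : (1 : ℝ) ≤ L := by exact_mod_cast hL
  have h₁ : (((L : ℝ) + ((-1 : ℤ) : ℝ)) / 2) * (((L : ℝ) - ((-1 : ℤ) : ℝ)) / 2 + 1)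
      = ((L : ℝ) - 1) / 2 * (((L : ℝ) + 3) / 2) := by push_cast; ring
  have h₂ : (((L : ℝ) - ((-1 - 2 : ℤ) : ℝ)) / 2) * (((L : ℝ) + ((-1 - 2 : ℤ) : ℝ)) / 2 + 1)
      = ((L : ℝ) - 1) / 2 * (((L : ℝ) + 3) / 2) := by push_cast; ring
  have h₀ : 0 ≤ ((L : ℝ) - 1) / 2 * (((L : ℝ) + 3) / 2) :=
    mul_nonneg (by linarith) (by linarith)
  rw [h.2.2.2 (-1), map_smul, h.2.2.1 (-1 - 2), h₁, h₂, smul_smul, ← Complex.ofReal_mul,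
    neg_mul_neg, Real.mul_self_sqrt h₀, sub_add_cancel]
  push_cast
  rfl

/-- `T₋` kills `ψ_{-1/2}` and `T₊` kills `ψ_{1/2}` in the spin-`1/2` module. -/
theorem IsSpinModule.spin_half_extremal (h : IsSpinModule 1 ψ T₀ Tp Tm) :
    Tp (ψ 1) = 0 ∧ Tm (ψ (-1)) = 0 := by
  rw [h.2.2.1 1, h.2.2.2 (-1)]
  norm_num

end SpinModule

end Spin

/- STATEMENT 12: For ℓ₂ = 1/2 (doubled spin 1) and ℓ₁ = k + 1/2 a half-odd-integer
(doubled spin 2k+1), the vector v = χ_{1/2} + χ_{-1/2} = ψ 1 ⊗ φ (-1) + ψ (-1) ⊗ φ 1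
satisfies D₀²v = -v, D₁v = -(ℓ₁² + 2ℓ₁ + 3/4)·v, D₂v = -(ℓ₁² - 1/4)·v and
D₃v = -i(ℓ₁ + 1/2)·(χ_{1/2} - χ_{-1/2}). -/

open Spin in
theorem stmt12 {U V : Type} [AddCommGroup U] [Module ℂ U] [AddCommGroup V] [Module ℂ V]
    (k : ℕ) (ψ : ℤ → U) (φ : ℤ → V)
    (T₀ Tp Tm : U →ₗ[ℂ] U) (W₀ Wp Wm : V →ₗ[ℂ] V)
    (hU : IsSpinModule (2 * k + 1) ψ T₀ Tp Tm) (hV : IsSpinModule 1 φ W₀ Wp Wm) :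
    Dzero T₀ W₀ (Dzero T₀ W₀ (ψ 1 ⊗ₜ[ℂ] φ (-1) + ψ (-1) ⊗ₜ[ℂ] φ 1))
      = -(ψ 1 ⊗ₜ[ℂ] φ (-1) + ψ (-1) ⊗ₜ[ℂ] φ 1) ∧
    Done Tp Tm Wp Wm (ψ 1 ⊗ₜ[ℂ] φ (-1) + ψ (-1) ⊗ₜ[ℂ] φ 1)
      = (-(((2 * (k : ℂ) + 1) / 2) ^ 2 + 2 * ((2 * (k : ℂ) + 1) / 2) + 3 / 4)) •
          (ψ 1 ⊗ₜ[ℂ] φ (-1) + ψ (-1) ⊗ₜ[ℂ] φ 1) ∧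
    Dtwo Tp Tm Wp Wm (ψ 1 ⊗ₜ[ℂ] φ (-1) + ψ (-1) ⊗ₜ[ℂ] φ 1)
      = (-(((2 * (k : ℂ) + 1) / 2) ^ 2 - 1 / 4)) •
          (ψ 1 ⊗ₜ[ℂ] φ (-1) + ψ (-1) ⊗ₜ[ℂ] φ 1) ∧
    Dthree Tp Tm Wp Wm (ψ 1 ⊗ₜ[ℂ] φ (-1) + ψ (-1) ⊗ₜ[ℂ] φ 1)
      = (-(Complex.I * ((2 * (k : ℂ) + 1) / 2 + 1 / 2))) •
          (ψ 1 ⊗ₜ[ℂ] φ (-1) - ψ (-1) ⊗ₜ[ℂ] φ 1) := by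
  have hT₀ : T₀ (ψ 1) = (1 / 2 : ℂ) • ψ 1 := by simpa using hU.2.1 1
  have hT₀' : T₀ (ψ (-1)) = (-1 / 2 : ℂ) • ψ (-1) := by simpa using hU.2.1 (-1)
  have hW₀ : W₀ (φ 1) = (1 / 2 : ℂ) • φ 1 := by simpa using hV.2.1 1
  have hW₀' : W₀ (φ (-1)) = (-1 / 2 : ℂ) • φ (-1) := by simpa using hV.2.1 (-1)
  have hTp := hU.raise_neg_one
  have hTm := hU.lower_one
  have hTmp := hU.lower_raise_one (by omega)
  have hTpm := hU.raise_lower_neg_one (by omega)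
  have hWp := hV.raise_neg_one
  have hWm := hV.lower_one
  obtain ⟨hWp₀, hWm₀⟩ := hV.spin_half_extremal
  push_cast at hTp hTm hTmp hTpm hWp hWm
  norm_num at hWp hWm
  refine ⟨?_, ?_, ?_, ?_⟩
  · simp only [Dzero, opT, opW, LinearMap.smul_apply, LinearMap.sub_apply, map_add, map_sub,
      map_smul, LinearMap.rTensor_tmul, LinearMap.lTensor_tmul, hT₀, hT₀', hW₀, hW₀',
      ← TensorProduct.smul_tmul', TensorProduct.tmul_smul]
    match_scalars <;> linear_combination Complex.I_sq
  all_goals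
    simp only [Done, Dtwo, Dthree, Dquad, Across, opT, opW, LinearMap.smul_apply,
      LinearMap.sub_apply, LinearMap.add_apply, LinearMap.comp_apply, map_add, map_neg, map_zero,
      map_smul, LinearMap.rTensor_tmul, LinearMap.lTensor_tmul, hTp, hTm, hTmp, hTpm, hWp, hWm,
      hWp₀, hWm₀, ← TensorProduct.smul_tmul', TensorProduct.tmul_neg,
      TensorProduct.tmul_zero]
    module
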